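/- Fix κ ∈ (0,1), q ∈ [0,1], w > 0, and a finite Borel measure μ on [0,1] having a continuous, everywhere positive density with respect to Lebesgue measure. Every pure-strategy Nash equilibrium (f*,a*) is regular, meaning: (a) for all p, p' ∈ [0,1] with p' > p, if f₁*(p) > 0 then f₁*(p') > 0, and if f₂*(p') > 0 then f₂*(p) > 0; (b) for all p ∈ [0,1], if f₁*(p) > 0 and q > p then a₁* > 0, and if a₁* > 0 and p > q then f₁*(p) > 0; (c) for all p ∈ [0,1], if f₂*(p) > 0 and 1−q > 1−p then a₂* > 0, and if a₂* > 0 and 1−p > 1−q then f₂*(p) > 0. -/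

import Mathlib

open MeasureTheory Set

noncomputable section

/-- `μ` is a finite Borel measure on `[0,1]` with a continuous, everywhere positive
density with respect to Lebesgue measure. -/
def NiceDensity (μ : Measure ℝ) : Prop :=
  ∃ g : ℝ → ℝ, ContinuousOn g (Icc 0 1) ∧ (∀ p ∈ Icc (0:ℝ) 1, 0 < g p) ∧
    μ = (volume.restrict (Icc (0:ℝ) 1)).withDensity (fun p => ENNReal.ofReal (g p))

/-- Total amount wagered by the diffuse players on Outcome 1. -/
def d1 (μ : Measure ℝ) (f : ℝ → ℝ × ℝ) : ℝ := ∫ p in Icc (0:ℝ) 1, (f p).1 ∂μ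

/-- Total amount wagered by the diffuse players on Outcome 2. -/
def d2 (μ : Measure ℝ) (f : ℝ → ℝ × ℝ) : ℝ := ∫ p in Icc (0:ℝ) 1, (f p).2 ∂μ

/-- The implied probability of Outcome 1, `P^{f,a}`. -/
def impliedProb (μ : Measure ℝ) (f : ℝ → ℝ × ℝ) (a : ℝ × ℝ) : ℝ :=
  (d1 μ f + a.1) / (d1 μ f + d2 μ f + a.1 + a.2)

/-- A feasible strategy profile for the diffuse players. -/
def FeasibleDiffuse (f : ℝ → ℝ × ℝ) : Prop :=
  Measurable f ∧ ∀ p ∈ Icc (0:ℝ) 1, 0 ≤ (f p).1 ∧ 0 ≤ (f p).2 ∧ (f p).1 + (f p).2 ≤ 1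

/-- A feasible strategy profile for the atomic player. -/
def FeasibleAtomic (w : ℝ) (a : ℝ × ℝ) : Prop := 0 ≤ a.1 ∧ 0 ≤ a.2 ∧ a.1 + a.2 ≤ w

/-- The expected profit of a bettor who believes Outcome 1 occurs with probability `p`,
betting `b1` on Outcome 1 and `b2` on Outcome 2, when the implied probability of
Outcome 1 is `P` (with the indicator conventions of the paper). -/
def payoff (κ P p b1 b2 : ℝ) : ℝ :=
  b1 * ((if P = 0 then 0 else κ * p / P) - 1) +
  b2 * ((if P = 1 then 0 else κ * (1 - p) / (1 - P)) - 1)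

/-- A pure-strategy Nash equilibrium. -/
def IsEquilibrium (κ q w : ℝ) (μ : Measure ℝ) (f : ℝ → ℝ × ℝ) (a : ℝ × ℝ) : Prop :=
  FeasibleDiffuse f ∧ FeasibleAtomic w a ∧
  0 < d1 μ f + d2 μ f + a.1 + a.2 ∧
  (∀ p ∈ Icc (0:ℝ) 1,
    payoff κ (impliedProb μ f a) p (f p).1 (f p).2 =
      sSup {x | ∃ b1 b2 : ℝ, 0 ≤ b1 ∧ 0 ≤ b2 ∧ b1 + b2 ≤ 1 ∧
        x = payoff κ (impliedProb μ f a) p b1 b2}) ∧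
  payoff κ (impliedProb μ f a) q a.1 a.2 =
    sSup {x | ∃ b1 b2 : ℝ, 0 ≤ b1 ∧ 0 ≤ b2 ∧ b1 + b2 ≤ w ∧
      0 < d1 μ f + d2 μ f + b1 + b2 ∧
      x = payoff κ (impliedProb μ f (b1, b2)) q b1 b2}

theorem payoff_swap (κ P p b1 b2 : ℝ) :
    payoff κ (1 - P) (1 - p) b2 b1 = payoff κ P p b1 b2 := by
  unfold payoff
  have h1 : (1 - P = 0) ↔ P = 1 := ⟨fun h => by linarith, fun h => by linarith⟩
  have h2 : (1 - P = 1) ↔ P = 0 := ⟨fun h => by linarith, fun h => by linarith⟩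
  simp only [h1, h2, sub_sub_cancel]
  ring

theorem payoff_mid (κ P p b1 b2 : ℝ) (h0 : P ≠ 0) (h1 : P ≠ 1) :
    payoff κ P p b1 b2 = b1 * (κ * p / P - 1) + b2 * (κ * (1 - p) / (1 - P) - 1) := by
  simp [payoff, h0, h1]

/-- Diffuse: a positive bet on outcome 1 forces a nonnegative margin. -/
theorem diffuse_pos (κ P p x y : ℝ) (hκ : κ ∈ Ioo (0:ℝ) 1) (hP0 : 0 < P) (hP1 : P < 1)
    (hx : 0 < x) (hy : 0 ≤ y)
    (hxy : x + y ≤ 1)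
    (hb : ∀ b1 b2 : ℝ, 0 ≤ b1 → 0 ≤ b2 → b1 + b2 ≤ 1 →
      payoff κ P p b1 b2 ≤ payoff κ P p x y) : P ≤ κ * p := by
  have h := hb 0 y le_rfl hy (by linarith)
  rw [payoff_mid _ _ _ _ _ hP0.ne' hP1.ne, payoff_mid _ _ _ _ _ hP0.ne' hP1.ne] at h
  have h2 : 0 ≤ x * (κ * p / P - 1) := by linarith
  have h3 : 0 ≤ κ * p / P - 1 := nonneg_of_mul_nonneg_right h2 hx
  have h4 : 1 ≤ κ * p / P := by linarith
  rwa [le_div_iff₀ hP0, one_mul] at h4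

theorem diffuse_bet (κ P p x y : ℝ) (hκ : κ ∈ Ioo (0:ℝ) 1) (hp : p ∈ Icc (0:ℝ) 1)
    (hP0 : 0 < P) (hP1 : P < 1)
    (hx : 0 ≤ x) (hy : 0 ≤ y)
    (hb : ∀ b1 b2 : ℝ, 0 ≤ b1 → 0 ≤ b2 → b1 + b2 ≤ 1 →
      payoff κ P p b1 b2 ≤ payoff κ P p x y) (hlt : P < κ * p) : 0 < x := by
  rcases hx.lt_or_eq with h | h
  · exact h
  exfalso
  subst h
  have h := hb 1 0 zero_le_one le_rfl (by norm_num)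
  rw [payoff_mid _ _ _ _ _ hP0.ne' hP1.ne, payoff_mid _ _ _ _ _ hP0.ne' hP1.ne] at h
  have h4 : 1 < κ * p / P := by rwa [lt_div_iff₀ hP0, one_mul]
  have hpp : κ * p ≤ p := by nlinarith [hκ.2, hp.1]
  have h5 : κ * (1 - p) / (1 - P) ≤ 1 := by
    rw [div_le_one (by linarith)]
    nlinarith [hκ.2, hκ.1, hp.2]
  nlinarith

/-- The atomic best response condition. -/
def AtomBR (κ q w D1 D2 a1 a2 : ℝ) : Prop :=
  ∀ b1 b2 : ℝ, 0 ≤ b1 → 0 ≤ b2 → b1 + b2 ≤ w → 0 < D1 + D2 + b1 + b2 →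
    payoff κ ((D1 + b1) / (D1 + D2 + b1 + b2)) q b1 b2 ≤
      payoff κ ((D1 + a1) / (D1 + D2 + a1 + a2)) q a1 a2

theorem prob_swap (D1 D2 b1 b2 : ℝ) (h : 0 < D1 + D2 + b1 + b2) :
    (D2 + b2) / (D2 + D1 + b2 + b1) = 1 - (D1 + b1) / (D1 + D2 + b1 + b2) := by
  have e : D2 + D1 + b2 + b1 = D1 + D2 + b1 + b2 := by ring
  rw [e]
  field_simp
  ring

theorem AtomBR.swap {κ q w D1 D2 a1 a2 : ℝ} (hT : 0 < D1 + D2 + a1 + a2)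
    (h : AtomBR κ q w D1 D2 a1 a2) : AtomBR κ (1 - q) w D2 D1 a2 a1 := by
  intro b2 b1 h2 h1 hw hpos
  have hpos' : 0 < D1 + D2 + b1 + b2 := by linarith
  rw [prob_swap _ _ _ _ hpos', prob_swap _ _ _ _ hT, payoff_swap, payoff_swap]
  exact h b1 b2 h1 h2 (by linarith) hpos'

theorem atom_pos {κ q w D1 D2 a1 a2 : ℝ} (hκ : κ ∈ Ioo (0:ℝ) 1)
    (hD1 : 0 ≤ D1) (hD2 : 0 ≤ D2) (ha1 : 0 < a1) (ha2 : 0 ≤ a2) (haw : a1 + a2 ≤ w)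
    (hP1 : (D1 + a1) / (D1 + D2 + a1 + a2) < 1)
    (h : AtomBR κ q w D1 D2 a1 a2) : (D1 + a1) / (D1 + D2 + a1 + a2) ≤ κ * q := by
  have hT : 0 < D1 + D2 + a1 + a2 := by linarith
  set P := (D1 + a1) / (D1 + D2 + a1 + a2) with hP
  have hP0 : 0 < P := by positivity
  have hPT : D1 + a1 = P * (D1 + D2 + a1 + a2) := by rw [hP]; field_simp
  rcases ha2.lt_or_eq with h2 | h2
  · exfalso
    set t := min a1 a2 with ht
    have ht0 : 0 < t := lt_min ha1 h2
    have ht1 : t ≤ a1 := min_le_left _ _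
    have ht2 : t ≤ a2 := min_le_right _ _
    have hT' : 0 < D1 + D2 + (a1 - t * P) + (a2 - t * (1 - P)) := by nlinarith
    have hd := h (a1 - t * P) (a2 - t * (1 - P)) (by nlinarith) (by nlinarith) (by nlinarith) hT'
    have e : (D1 + (a1 - t * P)) / (D1 + D2 + (a1 - t * P) + (a2 - t * (1 - P))) = P := by
      rw [div_eq_iff hT'.ne']
      linear_combination hPT
    rw [e, ← hP, payoff_mid _ _ _ _ _ hP0.ne' hP1.ne, payoff_mid _ _ _ _ _ hP0.ne' hP1.ne] at hd
    have e1 : P * (κ * q / P - 1) = κ * q - P := by field_simp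
    have hne : 1 - P ≠ 0 := by linarith
    have e2 : (1 - P) * (κ * (1 - q) / (1 - P) - 1) = κ * (1 - q) - (1 - P) := by field_simp
    have e3 : 0 ≤ t * (κ - 1) := by
      have : t * (κ - 1) = t * (P * (κ * q / P - 1)) +
        t * ((1 - P) * (κ * (1 - q) / (1 - P) - 1)) := by rw [e1, e2]; ring
      rw [this]; linarith
    nlinarith [hκ.2]
  · subst h2
    have hD : 0 < D1 + D2 + 0 + 0 := by
      rcases (add_nonneg hD1 hD2).lt_or_eq with h3 | h3
      · linarith
      · exfalso
        have : D1 + a1 = D1 + D2 + a1 + 0 := by linarith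
        nlinarith
    have hd := h 0 0 le_rfl le_rfl (by linarith) hD
    rw [← hP, payoff_mid κ P _ _ _ hP0.ne' hP1.ne] at hd
    have hz : ∀ R, payoff κ R q 0 0 = 0 := fun R => by simp [payoff]
    rw [hz] at hd
    have h3 : 0 ≤ κ * q / P - 1 := nonneg_of_mul_nonneg_right (by linarith) ha1
    have h4 : 1 ≤ κ * q / P := by linarith
    rwa [le_div_iff₀ hP0, one_mul] at h4

theorem atom_bet {κ q w D1 D2 a1 a2 : ℝ} (hκ : κ ∈ Ioo (0:ℝ) 1) (hq : q ∈ Icc (0:ℝ) 1)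
    (hw : 0 < w)
    (hD1 : 0 ≤ D1) (hD2 : 0 ≤ D2) (ha1 : 0 ≤ a1) (ha2 : 0 ≤ a2)
    (hT : 0 < D1 + D2 + a1 + a2)
    (hP0 : 0 < (D1 + a1) / (D1 + D2 + a1 + a2))
    (hP1 : (D1 + a1) / (D1 + D2 + a1 + a2) < 1)
    (h : AtomBR κ q w D1 D2 a1 a2) (hlt : (D1 + a1) / (D1 + D2 + a1 + a2) < κ * q) :
    0 < a1 := by
  rcases ha1.lt_or_eq with h1 | h1
  · exact h1
  exfalso
  subst h1
  have hD1' : 0 < D1 := by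
    have := (div_pos_iff_of_pos_right hT).1 hP0
    linarith
  set P := (D1 + 0) / (D1 + D2 + 0 + a2) with hP
  have hPT : D1 + 0 = P * (D1 + D2 + 0 + a2) := by rw [hP]; field_simp
  have hz : ∀ R, payoff κ R q 0 0 = 0 := fun R => by simp [payoff]
  have hd := h 0 0 le_rfl le_rfl (by linarith) (by linarith)
  rw [← hP, payoff_mid κ P _ _ _ hP0.ne' hP1.ne, hz] at hd
  have h5 : κ * (1 - q) / (1 - P) < 1 := by
    rw [div_lt_one (by linarith)]
    nlinarith [hκ.2, hκ.1, hq.2]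
  have h20 : a2 = 0 := by
    rcases ha2.lt_or_eq with h2 | h2
    · nlinarith
    · exact h2.symm
  subst h20
  have hgap : 0 < κ * q * (D1 + D2) - D1 := by nlinarith
  set e := min w (κ * q * (D1 + D2) - D1) with he
  have he0 : 0 < e := lt_min hw hgap
  have he1 : e ≤ w := min_le_left _ _
  have he2 : e ≤ κ * q * (D1 + D2) - D1 := min_le_right _ _
  have hTe : 0 < D1 + D2 + e + 0 := by linarith
  have hd2 := h e 0 he0.le le_rfl (by linarith) hTe
  rw [hz] at hd2
  have hne : (D1 + e) / (D1 + D2 + e + 0) ≠ 0 := by positivity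
  rw [add_zero] at hne
  simp only [payoff, zero_mul, add_zero] at hd2
  rw [if_neg hne] at hd2
  have hkq : 0 < κ * q := lt_trans hP0 hlt
  have h6 : 1 < κ * q / ((D1 + e) / (D1 + D2 + e)) := by
    rw [lt_div_iff₀ (by apply div_pos <;> linarith), one_mul, div_lt_iff₀ (by linarith)]
    nlinarith [mul_pos hkq he0]
  nlinarith

theorem atom_no_zero {κ q w a1 a2 : ℝ} (hκ : κ ∈ Ioo (0:ℝ) 1) (hq : q ∈ Icc (0:ℝ) 1)
    (ha1 : a1 = 0) (ha2 : 0 < a2) (haw : a1 + a2 ≤ w)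
    (h : AtomBR κ q w 0 0 a1 a2) : False := by
  subst ha1
  have hd := h 0 (a2 / 2) le_rfl (by linarith) (by linarith) (by linarith)
  simp [payoff] at hd
  nlinarith [hκ.1, hκ.2, hq.1, hq.2, mul_nonneg hκ.1.le hq.1]

theorem prob_pos {κ q w D1 D2 a1 a2 : ℝ} {x y : ℝ → ℝ}
    (hκ : κ ∈ Ioo (0:ℝ) 1) (hq : q ∈ Icc (0:ℝ) 1)
    (hD1 : 0 ≤ D1) (hD2 : 0 ≤ D2) (ha1 : 0 ≤ a1) (ha2 : 0 ≤ a2) (haw : a1 + a2 ≤ w)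
    (hT : 0 < D1 + D2 + a1 + a2)
    (hx : ∀ p ∈ Icc (0:ℝ) 1, 0 ≤ x p) (hy : ∀ p ∈ Icc (0:ℝ) 1, 0 ≤ y p)
    (hb : ∀ p ∈ Icc (0:ℝ) 1, ∀ b1 b2 : ℝ, 0 ≤ b1 → 0 ≤ b2 → b1 + b2 ≤ 1 →
      payoff κ ((D1 + a1) / (D1 + D2 + a1 + a2)) p b1 b2 ≤
        payoff κ ((D1 + a1) / (D1 + D2 + a1 + a2)) p (x p) (y p))
    (hy0 : (∀ p ∈ Icc (0:ℝ) 1, y p = 0) → D2 = 0)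
    (h : AtomBR κ q w D1 D2 a1 a2) : 0 < (D1 + a1) / (D1 + D2 + a1 + a2) := by
  rcases (add_nonneg hD1 ha1).lt_or_eq with h1 | h1
  · positivity
  exfalso
  have e1 : D1 = 0 := by linarith
  have e2 : a1 = 0 := by linarith
  subst e1 e2
  have hD20 : D2 = 0 := by
    apply hy0
    intro p hp
    have hd := hb p hp 0 0 le_rfl le_rfl (by norm_num)
    simp [payoff] at hd
    have hk : κ * (1 - p) < 1 := by nlinarith [hκ.1, hκ.2, hp.1, hp.2, mul_nonneg hκ.1.le hp.1]
    have := hx p hp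
    have := hy p hp
    nlinarith
  subst hD20
  exact atom_no_zero hκ hq rfl (by linarith) haw h

theorem mul_div_bound (c b D T : ℝ) (hc0 : 0 ≤ c) (hc1 : c ≤ 1) (hb : 0 ≤ b) (hD : 0 ≤ D)
    (hT : 0 < T) (R : ℝ) (hR : R = (D + b) / T) :
    b * ((if R = 0 then 0 else c / R) - 1) ≤ T := by
  split_ifs with h0
  · linarith
  · have hpos : 0 < D + b := by
      rcases (add_nonneg hD hb).lt_or_eq with h | h
      · exact h
      · exact absurd (by rw [hR, ← h, zero_div]) h0
    have : b * (c / R) ≤ T := by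
      rw [hR, div_div_eq_mul_div, ← mul_div_assoc, div_le_iff₀ hpos]
      have : c * (T * b) ≤ 1 * (T * b) := by gcongr
      nlinarith
    linarith

/-- Corollary: every equilibrium is regular: whenever some player wagers on an
outcome, every player who believes that outcome more likely also wagers on it. -/
theorem stmt_10 (κ q w : ℝ) (hκ : κ ∈ Ioo (0:ℝ) 1) (hq : q ∈ Icc (0:ℝ) 1) (hw : 0 < w)
    (μ : Measure ℝ) (hμ : NiceDensity μ)
    (f : ℝ → ℝ × ℝ) (a : ℝ × ℝ) (h : IsEquilibrium κ q w μ f a) :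
    (∀ p ∈ Icc (0:ℝ) 1, ∀ p' ∈ Icc (0:ℝ) 1, p < p' →
      (0 < (f p).1 → 0 < (f p').1) ∧ (0 < (f p').2 → 0 < (f p).2)) ∧
    (∀ p ∈ Icc (0:ℝ) 1,
      (0 < (f p).1 → p < q → 0 < a.1) ∧ (0 < a.1 → q < p → 0 < (f p).1)) ∧
    (∀ p ∈ Icc (0:ℝ) 1,
      (0 < (f p).2 → 1 - p < 1 - q → 0 < a.2) ∧ (0 < a.2 → 1 - q < 1 - p → 0 < (f p).2)) := by
  obtain ⟨⟨hfm, hf⟩, ⟨ha1, ha2, haw⟩, hT, hdiff, hatom⟩ := h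
  have hD1 : 0 ≤ d1 μ f := setIntegral_nonneg measurableSet_Icc fun p hp => (hf p hp).1
  have hD2 : 0 ≤ d2 μ f := setIntegral_nonneg measurableSet_Icc fun p hp => (hf p hp).2.1
  have hz1 : (∀ p ∈ Icc (0:ℝ) 1, (f p).1 = 0) → d1 μ f = 0 := fun h =>
    setIntegral_eq_zero_of_forall_eq_zero h
  have hz2 : (∀ p ∈ Icc (0:ℝ) 1, (f p).2 = 0) → d2 μ f = 0 := fun h =>
    setIntegral_eq_zero_of_forall_eq_zero h
  have hBR : AtomBR κ q w (d1 μ f) (d2 μ f) a.1 a.2 := by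
    intro b1 b2 h1 h2 h3 h4
    change payoff κ (impliedProb μ f (b1, b2)) q b1 b2 ≤ payoff κ (impliedProb μ f a) q a.1 a.2
    rw [hatom]
    refine le_csSup ?_ ⟨b1, b2, h1, h2, h3, h4, rfl⟩
    refine ⟨2 * (d1 μ f + d2 μ f + w), ?_⟩
    rintro x ⟨c1, c2, k1, k2, k3, k4, rfl⟩
    have m1 := mul_div_bound (κ * q) c1 (d1 μ f) _ (mul_nonneg hκ.1.le hq.1)
      (by nlinarith [hκ.1, hκ.2, hq.1, hq.2]) k1 hD1 k4 (impliedProb μ f (c1, c2)) rfl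
    have m2 := mul_div_bound (κ * (1 - q)) c2 (d2 μ f) _
      (mul_nonneg hκ.1.le (by linarith [hq.2]))
      (by nlinarith [hκ.1, hκ.2, hq.1, hq.2, mul_nonneg hκ.1.le hq.1]) k2 hD2 k4
      (1 - impliedProb μ f (c1, c2))
      (by
        have := prob_swap _ _ _ _ k4
        rw [show d2 μ f + d1 μ f + c2 + c1 = d1 μ f + d2 μ f + c1 + c2 by ring] at this
        exact this.symm)
    have hiff : (1 - impliedProb μ f (c1, c2) = 0) ↔ impliedProb μ f (c1, c2) = 1 :=
      ⟨fun h => by linarith, fun h => by linarith⟩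
    simp only [hiff] at m2
    unfold payoff
    linarith
  have hb : ∀ p ∈ Icc (0:ℝ) 1, ∀ b1 b2 : ℝ, 0 ≤ b1 → 0 ≤ b2 → b1 + b2 ≤ 1 →
      payoff κ (impliedProb μ f a) p b1 b2 ≤
        payoff κ (impliedProb μ f a) p (f p).1 (f p).2 := by
    intro p hp b1 b2 h1 h2 h3
    rw [hdiff p hp]
    refine le_csSup ?_ ⟨b1, b2, h1, h2, h3, rfl⟩
    unfold payoff
    generalize ((if impliedProb μ f a = 0 then 0 else κ * p / impliedProb μ f a) - 1 : ℝ) = u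
    generalize ((if impliedProb μ f a = 1 then 0
      else κ * (1 - p) / (1 - impliedProb μ f a)) - 1 : ℝ) = v
    refine ⟨|u| + |v|, ?_⟩
    rintro x ⟨c1, c2, k1, k2, k3, rfl⟩
    have n1 : c1 * u ≤ |u| := by nlinarith [le_abs_self u, abs_nonneg u]
    have n2 : c2 * v ≤ |v| := by nlinarith [le_abs_self v, abs_nonneg v]
    linarith
  have hb' : ∀ p ∈ Icc (0:ℝ) 1, ∀ b2 b1 : ℝ, 0 ≤ b2 → 0 ≤ b1 → b2 + b1 ≤ 1 →
      payoff κ (1 - impliedProb μ f a) (1 - p) b2 b1 ≤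
        payoff κ (1 - impliedProb μ f a) (1 - p) (f p).2 (f p).1 := by
    intro p hp b2 b1 h2 h1 h3
    rw [payoff_swap, payoff_swap]
    exact hb p hp b1 b2 h1 h2 (by linarith)
  have hI : ∀ p ∈ Icc (0:ℝ) 1, 1 - p ∈ Icc (0:ℝ) 1 := fun p hp =>
    ⟨by linarith [hp.2], by linarith [hp.1]⟩
  have hBR' := hBR.swap hT
  have hT' : 0 < d2 μ f + d1 μ f + a.2 + a.1 := by linarith
  have hsw : (d2 μ f + a.2) / (d2 μ f + d1 μ f + a.2 + a.1) = 1 - impliedProb μ f a :=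
    prob_swap _ _ _ _ hT
  have hP0 : 0 < impliedProb μ f a :=
    prob_pos (x := fun p => (f p).1) (y := fun p => (f p).2) hκ hq hD1 hD2 ha1 ha2 haw hT
      (fun p hp => (hf p hp).1) (fun p hp => (hf p hp).2.1) hb hz2 hBR
  have hP1 : 0 < 1 - impliedProb μ f a := by
    rw [← hsw]
    refine prob_pos (x := fun p => (f (1 - p)).2) (y := fun p => (f (1 - p)).1) hκ (hI q hq)
      hD2 hD1 ha2 ha1 (by linarith) hT'
      (fun p hp => (hf _ (hI p hp)).2.1) (fun p hp => (hf _ (hI p hp)).1) ?_ ?_ hBR'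
    · intro p hp
      rw [hsw]
      have := hb' (1 - p) (hI p hp)
      rwa [sub_sub_cancel] at this
    · intro h
      apply hz1
      intro p hp
      have := h (1 - p) (hI p hp)
      simpa using this
  have hP1' : impliedProb μ f a < 1 := by linarith
  have hP0' : 1 - impliedProb μ f a < 1 := by linarith
  have A1 : ∀ p ∈ Icc (0:ℝ) 1, 0 < (f p).1 → impliedProb μ f a ≤ κ * p := fun p hp h =>
    diffuse_pos κ _ p _ _ hκ hP0 hP1' h (hf p hp).2.1 (hf p hp).2.2 (hb p hp)
  have A2 : ∀ p ∈ Icc (0:ℝ) 1, impliedProb μ f a < κ * p → 0 < (f p).1 := fun p hp h =>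
    diffuse_bet κ _ p _ _ hκ hp hP0 hP1' (hf p hp).1 (hf p hp).2.1 (hb p hp) h
  have B1 : ∀ p ∈ Icc (0:ℝ) 1, 0 < (f p).2 → 1 - impliedProb μ f a ≤ κ * (1 - p) :=
    fun p hp h => diffuse_pos κ _ _ _ _ hκ hP1 hP0' h (hf p hp).1
      (by linarith [(hf p hp).2.2]) (hb' p hp)
  have B2 : ∀ p ∈ Icc (0:ℝ) 1, 1 - impliedProb μ f a < κ * (1 - p) → 0 < (f p).2 :=
    fun p hp h => diffuse_bet κ _ _ _ _ hκ (hI p hp) hP1 hP0' (hf p hp).2.1 (hf p hp).1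
      (hb' p hp) h
  have C1 : 0 < a.1 → impliedProb μ f a ≤ κ * q := fun h =>
    atom_pos hκ hD1 hD2 h ha2 haw hP1' hBR
  have C2 : impliedProb μ f a < κ * q → 0 < a.1 := fun h =>
    atom_bet hκ hq hw hD1 hD2 ha1 ha2 hT hP0 hP1' hBR h
  have E1 : 0 < a.2 → 1 - impliedProb μ f a ≤ κ * (1 - q) := fun h => by
    have := atom_pos hκ hD2 hD1 h ha1 (by linarith) (by rw [hsw]; exact hP0') hBR'
    rwa [hsw] at this
  have E2 : 1 - impliedProb μ f a < κ * (1 - q) → 0 < a.2 := fun h =>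
    atom_bet hκ (hI q hq) hw hD2 hD1 ha2 ha1 hT' (by rw [hsw]; exact hP1)
      (by rw [hsw]; exact hP0') hBR' (by rw [hsw]; exact h)
  have mono : ∀ s t : ℝ, s < t → κ * s < κ * t := fun s t h => mul_lt_mul_of_pos_left h hκ.1
  refine ⟨fun p hp p' hp' hlt => ⟨fun h => ?_, fun h => ?_⟩,
    fun p hp => ⟨fun h hlt => ?_, fun h hlt => ?_⟩, fun p hp => ⟨fun h hlt => ?_, fun h hlt => ?_⟩⟩
  · exact A2 p' hp' ((A1 p hp h).trans_lt (mono _ _ hlt))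
  · exact B2 p hp ((B1 p' hp' h).trans_lt (mono _ _ (by linarith)))
  · exact C2 ((A1 p hp h).trans_lt (mono _ _ hlt))
  · exact A2 p hp ((C1 h).trans_lt (mono _ _ hlt))
  · exact E2 ((B1 p hp h).trans_lt (mono _ _ hlt))
  · exact B2 p hp ((E1 h).trans_lt (mono _ _ hlt))
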